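/- Let C and D be real symmetric L×L matrices with C positive definite and D not positive definite. Then there exists t_0 ∈ ℝ with t_0 ≥ 0 such that for every t ∈ ℝ, the matrix C·t + D is positive definite if and only if t > t_0. -/

import Mathlib

/-- A degree-zero homogeneous function that is continuous away from the origin attains its
maximum over the nonzero vectors of a finite-dimensional real normed space. -/
theorem exists_ne_zero_forall_le_of_homogeneous {E : Type*} [NormedAddCommGroup E]
    [NormedSpace ℝ E] [FiniteDimensional ℝ E] [Nontrivial E] {f : E → ℝ}
    (hf : ContinuousOn f {0}ᶜ) (hhom : ∀ c : ℝ, c ≠ 0 → ∀ x, f (c • x) = f x) :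
    ∃ x ≠ 0, ∀ y ≠ 0, f y ≤ f x := by
  have := FiniteDimensional.proper_real E
  obtain ⟨x, hx, hmax⟩ := (isCompact_sphere (0 : E) 1).exists_isMaxOn
    (NormedSpace.sphere_nonempty.2 zero_le_one)
    (hf.mono fun x hx ↦ ne_zero_of_mem_unit_sphere ⟨x, hx⟩)
  refine ⟨x, ne_zero_of_mem_unit_sphere ⟨x, hx⟩, fun y hy ↦ ?_⟩
  rw [← hhom ‖y‖⁻¹ (inv_ne_zero (norm_ne_zero_iff.2 hy))]
  exact hmax (by simp [norm_smul, hy])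

open Matrix in
/-- For `C` positive definite, positive definiteness of `t • C + D` amounts to `t` exceeding
all negated generalized Rayleigh quotients of `D` with respect to `C`. -/
theorem Matrix.PosDef.smul_add_iff_forall_neg_div_lt {n : Type*} [Fintype n]
    {C D : Matrix n n ℝ} (hC : C.PosDef) (hD : D.IsHermitian) (t : ℝ) :
    (t • C + D).PosDef ↔ ∀ x ≠ 0, -(x ⬝ᵥ D *ᵥ x) / (x ⬝ᵥ C *ᵥ x) < t := by
  have hH : (t • C + D).IsHermitian := (hC.isHermitian.smul (IsSelfAdjoint.all t)).add hD
  rw [posDef_iff_dotProduct_mulVec, and_iff_right hH]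
  refine forall₂_congr fun x hx ↦ ?_
  have hpos : 0 < x ⬝ᵥ C *ᵥ x := by simpa using hC.dotProduct_mulVec_pos hx
  rw [div_lt_iff₀ hpos, star_trivial, add_mulVec, smul_mulVec, dotProduct_add,
    dotProduct_smul, smul_eq_mul, neg_lt_iff_pos_add]

/-- If `C` is a real symmetric positive definite matrix and `D` is a real symmetric
matrix that is not positive definite, then there is a threshold `t₀ ≥ 0` such that
`C·t + D` is positive definite exactly for `t > t₀`. -/
theorem posDef_threshold (L : ℕ) (C D : Matrix (Fin L) (Fin L) ℝ)
    (hCsymm : C.IsSymm) (hDsymm : D.IsSymm)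
    (hC : C.PosDef) (hD : ¬ D.PosDef) :
    ∃ t0 : ℝ, 0 ≤ t0 ∧ ∀ t : ℝ, (t • C + D).PosDef ↔ t0 < t := by
  have hDH : D.IsHermitian := D.conjTranspose_eq_transpose_of_trivial.trans hDsymm
  have key := hC.smul_add_iff_forall_neg_div_lt hDH
  have : Nontrivial (Fin L → ℝ) := by
    by_contra h
    rw [not_nontrivial_iff_subsingleton] at h
    have h0 := (key 0).2 fun x hx ↦ absurd (Subsingleton.elim x 0) hx
    simp [hD] at h0
  obtain ⟨x, hx, hmax⟩ := exists_ne_zero_forall_le_of_homogeneous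
    (f := fun x : Fin L → ℝ ↦ -(x ⬝ᵥ D.mulVec x) / (x ⬝ᵥ C.mulVec x))
    (by
      refine ContinuousOn.div (by fun_prop) (by fun_prop) fun x hx ↦ ?_
      simpa using (hC.dotProduct_mulVec_pos hx).ne')
    (fun c hc x ↦ by
      simp only [Matrix.mulVec_smul, dotProduct_smul, smul_dotProduct, smul_eq_mul, ← mul_neg]
      rw [mul_div_mul_left _ _ hc, mul_div_mul_left _ _ hc])
  have hiff (t : ℝ) : (t • C + D).PosDef ↔ -(x ⬝ᵥ D.mulVec x) / (x ⬝ᵥ C.mulVec x) < t :=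
    (key t).trans ⟨fun h ↦ h x hx, fun h y hy ↦ (hmax y hy).trans_lt h⟩
  refine ⟨_, not_lt.1 fun h ↦ hD ?_, hiff⟩
  simpa using (hiff 0).2 h
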